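/- Let A and B be unital C*-algebras and let Φ : A → B be a bijective ℂ-linear map with Φ(1) = 1 such that for every n ∈ ℕ the entrywise amplification Φₙ : Mₙ(A) → Mₙ(B), (x_{ij}) ↦ (Φ(x_{ij})), is isometric for the unique C*-norms on the matrix C*-algebras Mₙ(A) and Mₙ(B). Then Φ is a *-isomorphism: Φ(x y) = Φ(x) Φ(y) and Φ(x*) = Φ(x)* for all x, y ∈ A. (Proposition 1.) -/

import Mathlib

/-- A C*-norm on a star ring which is also a complex module: a faithful submultiplicative
ℂ-homogeneous norm satisfying the C*-identity `N (x* x) = (N x)²`.  On the matrix algebra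
`Mₙ(A)` over a unital C*-algebra such a norm exists and is unique. -/
structure IsCStarNorm {R : Type*} [Ring R] [StarRing R] [Module ℂ R] (N : R → ℝ) : Prop where
  nonneg : ∀ x, 0 ≤ N x
  eq_zero : ∀ x, N x = 0 → x = 0
  add_le : ∀ x y, N (x + y) ≤ N x + N y
  smul : ∀ (c : ℂ) (x), N (c • x) = ‖c‖ * N x
  mul_le : ∀ x y, N (x * y) ≤ N x * N y
  cstar : ∀ x, N (star x * x) = N x ^ 2

theorem isSelfAdjoint_map_of_unital_contraction {A B : Type*} [CStarAlgebra A] [CStarAlgebra B]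
    (f : A →ₗ[ℂ] B) (hone : f 1 = 1) (hf : ∀ x, ‖f x‖ ≤ ‖x‖) {a : A} (ha : IsSelfAdjoint a) :
    IsSelfAdjoint (f a) := by
  cases subsingleton_or_nontrivial B
  · exact Subsingleton.elim _ _
  have : Nontrivial A := ⟨⟨1, 0, fun h => one_ne_zero (by rw [← hone, h, map_zero])⟩⟩
  set h : B := (imaginaryPart (f a) : B) with hh
  have hsa : IsSelfAdjoint h := (imaginaryPart (f a)).2
  have key (t : ℝ) : ‖h + algebraMap ℝ B t‖ ^ 2 ≤ ‖a‖ ^ 2 + t ^ 2 := by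
    have h1 : h + algebraMap ℝ B t = (imaginaryPart (f (a + (Complex.I * t) • 1)) : B) := by
      have ht : (imaginaryPart ((Complex.I * t) • (1 : B)) : B) = algebraMap ℝ B t := by
        rw [mul_smul, imaginaryPart_I_smul, IsSelfAdjoint.coe_realPart]
        · simp [Algebra.algebraMap_eq_smul_one]
        · simp [IsSelfAdjoint]
      rw [map_add, map_smul, hone, map_add, AddSubgroup.coe_add, ht]
    have h2 : ‖h + algebraMap ℝ B t‖ ≤ ‖a + (Complex.I * t) • (1 : A)‖ := by
      rw [h1]; exact (imaginaryPart.norm_le _).trans (hf _)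
    have h3 : ‖a + (Complex.I * t) • (1 : A)‖ ^ 2 ≤ ‖a‖ ^ 2 + t ^ 2 := by
      rw [sq, ← CStarRing.norm_star_mul_self]
      have : star (a + (Complex.I * t) • (1 : A)) * (a + (Complex.I * t) • (1 : A))
          = star a * a + ((t : ℂ) ^ 2) • (1 : A) := by
        simp [ha.star_eq, add_mul, mul_add, smul_smul]
        rw [← neg_smul]
        congr 1
        linear_combination (-(t : ℂ) ^ 2) * Complex.I_sq
      rw [this]
      refine (norm_add_le _ _).trans ?_
      rw [CStarRing.norm_star_mul_self, norm_smul]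
      simp [sq]
    exact (pow_le_pow_left₀ (norm_nonneg _) h2 2).trans h3
  have h0 : h = 0 := by
    refine CFC.eq_zero_of_spectrum_subset_zero (R := ℝ) h (fun l hl => ?_) hsa
    have hl (t : ℝ) : (l + t) ^ 2 ≤ ‖a‖ ^ 2 + t ^ 2 := by
      have : l + t ∈ spectrum ℝ (h + algebraMap ℝ B t) := by
        rw [add_comm l t, add_comm h]
        simpa [← spectrum.singleton_add_eq] using hl
      have := spectrum.norm_le_norm_of_mem this
      refine le_trans ?_ (key t)
      rw [← sq_abs]
      exact pow_le_pow_left₀ (abs_nonneg _) this 2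
    by_contra hne
    have hne : l ≠ 0 := hne
    have := hl ((‖a‖ ^ 2) / (2 * l))
    have e : l * (‖a‖ ^ 2 / (2 * l)) = ‖a‖ ^ 2 / 2 := by field_simp
    have := sq_pos_of_ne_zero hne
    nlinarith
  have := realPart_add_I_smul_imaginaryPart (f a)
  rw [← hh, h0, smul_zero, add_zero] at this
  rw [← this]
  exact (realPart (f a)).2

theorem map_nonneg_of_unital_contraction {A B : Type*} [CStarAlgebra A] [CStarAlgebra B]
    [PartialOrder A] [StarOrderedRing A] [PartialOrder B] [StarOrderedRing B]
    (f : A →ₗ[ℂ] B) (hone : f 1 = 1) (hf : ∀ x, ‖f x‖ ≤ ‖x‖) {a : A} (ha : 0 ≤ a) :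
    0 ≤ f a := by
  have hsa := IsSelfAdjoint.of_nonneg ha
  have hfa := isSelfAdjoint_map_of_unital_contraction f hone hf hsa
  rw [nonneg_iff_isSelfAdjoint_and_quasispectrumRestricts,
    quasispectrumRestricts_iff_spectrumRestricts] at ha ⊢
  refine ⟨hfa, ?_⟩
  rw [SpectrumRestricts.nnreal_iff_nnnorm hfa (t := ‖a‖₊) (hf a)]
  have := (SpectrumRestricts.nnreal_iff_nnnorm hsa (t := ‖a‖₊) le_rfl).1 ha.2
  have h2 := hf (algebraMap ℝ A ‖a‖ - a)
  refine NNReal.coe_le_coe.1 ((le_of_eq ?_).trans (h2.trans (NNReal.coe_le_coe.2 this)))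
  simp [Algebra.algebraMap_eq_smul_one, hone]

theorem exists_eq_star_mul_self_of_nonneg {A : Type*} [CStarAlgebra A] [PartialOrder A]
    [StarOrderedRing A] {a : A} (ha : 0 ≤ a) : ∃ x, a = star x * x :=
  CStarAlgebra.nonneg_iff_eq_star_mul_self.1 ha

open CStarMatrix in
theorem star_mul_le_map_of_two_contraction {A B : Type*} [CStarAlgebra A] [CStarAlgebra B]
    [PartialOrder A] [StarOrderedRing A] [PartialOrder B] [StarOrderedRing B]
    (f : A →ₗ[ℂ] B) (hone : f 1 = 1)
    (hf : ∀ M : CStarMatrix (Fin 2) (Fin 2) A, ‖M.map f‖ ≤ ‖M‖) (a : A) :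
    f (star a) = star (f a) ∧ star (f a) * f a ≤ f (star a * a) := by
  let N : CStarMatrix (Fin 2) (Fin 2) A := ofMatrix !![1, a; 0, 0]
  let P : CStarMatrix (Fin 2) (Fin 2) A := ofMatrix !![1, a; star a, star a * a]
  have hP : 0 ≤ P := by
    have : P = star N * N := by
      ext i j
      fin_cases i <;> fin_cases j <;> simp [P, N, CStarMatrix.mul_apply, CStarMatrix.star_apply]
    rw [this]
    exact star_mul_self_nonneg N
  have hmap : 0 ≤ P.map f := by
    refine map_nonneg_of_unital_contraction (mapₗ f) ?_ hf hP
    ext i j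
    fin_cases i <;> fin_cases j <;> simp [hone]
  have hstar : f (star a) = star (f a) := by
    have := (IsSelfAdjoint.of_nonneg hmap).star_eq
    have := congrFun (congrFun this 1) 0
    simpa [P, CStarMatrix.star_apply] using this.symm
  refine ⟨hstar, ?_⟩
  obtain ⟨X, hX⟩ := exists_eq_star_mul_self_of_nonneg hmap
  let V : CStarMatrix (Fin 2) (Fin 2) B := ofMatrix !![0, -f a; 0, 1]
  have h1 : star V * P.map f * V = star (X * V) * (X * V) := by
    rw [hX, star_mul]; simp only [mul_assoc]
  have h2 := congrFun (congrFun h1 1) 1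
  have h3 : (star V * P.map f * V) 1 1 = f (star a * a) - star (f a) * f a := by
    simp [V, P, CStarMatrix.mul_apply, CStarMatrix.star_apply, hone, hstar]
    abel
  have h4 : 0 ≤ (star (X * V) * (X * V)) 1 1 := by
    rw [CStarMatrix.mul_apply]
    exact Finset.sum_nonneg fun i _ => by
      rw [CStarMatrix.star_apply]; exact star_mul_self_nonneg _
  rw [← h2, h3] at h4
  exact sub_nonneg.1 h4

theorem map_star_mul_of_map_star_mul_self {A B : Type*} [CStarAlgebra A] [CStarAlgebra B]
    (f : A →ₗ[ℂ] B) (h : ∀ x, f (star x * x) = star (f x) * f x) (x y : A) :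
    f (star x * y) = star (f x) * f y := by
  have h1 := h (x + y)
  have h2 := h (x + Complex.I • y)
  simp only [star_add, map_add, add_mul, mul_add, h, star_smul, map_smul, smul_mul_assoc,
    mul_smul_comm] at h1 h2
  have e1 : f (star x * y) - star (f x) * f y + (f (star y * x) - star (f y) * f x) = 0 := by
    rw [← sub_eq_zero.2 h1]
    module
  have e2 : Complex.I • (f (star x * y) - star (f x) * f y)
      - Complex.I • (f (star y * x) - star (f y) * f x) = 0 := by
    rw [← sub_eq_zero.2 h2]
    simp
    module
  rw [← smul_sub, smul_eq_zero_iff_right Complex.I_ne_zero] at e2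
  have e3 : (2 : ℂ) • (f (star x * y) - star (f x) * f y) = 0 := by
    refine Eq.trans ?_ ((congrArg₂ (· + ·) e1 e2).trans (add_zero 0))
    module
  rw [smul_eq_zero_iff_right two_ne_zero] at e3
  exact sub_eq_zero.1 e3

theorem CStarMatrix.isCStarNorm_norm {A : Type*} [CStarAlgebra A] [PartialOrder A]
    [StarOrderedRing A] (n : ℕ) :
    IsCStarNorm fun M : Matrix (Fin n) (Fin n) A => ‖CStarMatrix.ofMatrix M‖ where
  nonneg _ := norm_nonneg _
  eq_zero _ h := norm_eq_zero.1 h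
  add_le x y := norm_add_le (CStarMatrix.ofMatrix x) (CStarMatrix.ofMatrix y)
  smul c x := norm_smul c (CStarMatrix.ofMatrix x)
  mul_le x y := norm_mul_le (CStarMatrix.ofMatrix x) (CStarMatrix.ofMatrix y)
  cstar x := (CStarRing.norm_star_mul_self (x := CStarMatrix.ofMatrix x)).trans (sq _).symm

/-- **Proposition 1.** A bijective unital linear complete isometry `Φ` between unital
C*-algebras (i.e. every entrywise amplification `Φₙ : Mₙ(A) → Mₙ(B)` is isometric for the
unique C*-norms on the matrix algebras) is a *-isomorphism. -/
theorem prop1_unital_complete_isometry_is_star_isomorphism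
    {A B : Type*} [CStarAlgebra A] [CStarAlgebra B]
    (Φ : A →ₗ[ℂ] B) (hbij : Function.Bijective Φ) (hone : Φ 1 = 1)
    (hiso : ∀ (n : ℕ) (NA : Matrix (Fin n) (Fin n) A → ℝ) (NB : Matrix (Fin n) (Fin n) B → ℝ),
      IsCStarNorm NA → IsCStarNorm NB →
      ∀ M : Matrix (Fin n) (Fin n) A, NB (M.map Φ) = NA M) :
    (∀ x y : A, Φ (x * y) = Φ x * Φ y) ∧ (∀ x : A, Φ (star x) = star (Φ x)) := by
  let _ := CStarAlgebra.spectralOrder A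
  let _ := CStarAlgebra.spectralOrder B
  have _ := CStarAlgebra.spectralOrderedRing A
  have _ := CStarAlgebra.spectralOrderedRing B
  have hΦ (M : CStarMatrix (Fin 2) (Fin 2) A) : ‖M.map Φ‖ = ‖M‖ :=
    hiso 2 _ _ (CStarMatrix.isCStarNorm_norm 2) (CStarMatrix.isCStarNorm_norm 2) M
  let e := LinearEquiv.ofBijective Φ hbij
  have he (x : A) : e x = Φ x := rfl
  have hsymm (M : CStarMatrix (Fin 2) (Fin 2) B) : ‖M.map e.symm‖ ≤ ‖M‖ := by
    rw [← hΦ]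
    refine le_of_eq (congrArg _ ?_)
    ext i j
    exact e.apply_symm_apply (M i j)
  have hschwarz := star_mul_le_map_of_two_contraction Φ hone fun M => (hΦ M).le
  have hschwarz_symm := star_mul_le_map_of_two_contraction (e.symm : B →ₗ[ℂ] A)
    (e.symm_apply_eq.2 hone.symm) hsymm
  have hpos {a : A} (ha : 0 ≤ a) : 0 ≤ Φ a := by
    obtain ⟨x, rfl⟩ := exists_eq_star_mul_self_of_nonneg ha
    exact (star_mul_self_nonneg _).trans (hschwarz x).2
  have hsq (x : A) : Φ (star x * x) = star (Φ x) * Φ x := by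
    refine le_antisymm ?_ (hschwarz x).2
    have h := (hschwarz_symm (e x)).2
    simp only [LinearEquiv.coe_coe, LinearEquiv.symm_apply_apply] at h
    have h' := hpos (sub_nonneg.2 h)
    rw [map_sub, sub_nonneg, ← he (e.symm _), e.apply_symm_apply] at h'
    exact h'
  refine ⟨fun x y => ?_, fun x => (hschwarz x).1⟩
  have h := map_star_mul_of_map_star_mul_self Φ hsq (star x) y
  rwa [(hschwarz x).1, star_star, star_star] at h
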